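/- For every integer t ≥ 4, the inducibility of K_t^- equals C(t,2)·(q−1)(q−2)···(q−(t−2))/q^{t−1}, where q = ⌈(t−2)(3t+1)/6⌉; in particular ind(K_4^-) = 72/125 and ind(K_5^-) = 525/1024. -/

import Mathlib

/-- The number of induced copies of `F` in `G`. -/
noncomputable def inducedCount {α β : Type*} [Fintype α] [Fintype β]
    (F : SimpleGraph α) (G : SimpleGraph β) : ℕ :=
  Set.ncard {s : Finset β | Nonempty (G.induce (s : Set β) ≃g F)}

/-- The complete graph on `t` vertices minus the edge `{0,1}`. -/
def Kminus (t : ℕ) : SimpleGraph (Fin t) :=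
  SimpleGraph.fromRel (fun a b => 2 ≤ a.val ∨ 2 ≤ b.val)

/-- `q(t) = ⌈(t−2)(3t+1)/6⌉`. -/
noncomputable def qval (t : ℕ) : ℕ := ⌈(((t : ℚ) - 2) * (3 * (t : ℚ) + 1)) / 6⌉₊

/-- `C(t,2)·(q−1)(q−2)⋯(q−(t−2))/q^{t−1}` with `q = q(t)`. -/
noncomputable def indVal (t : ℕ) : ℝ :=
  (t.choose 2 : ℝ) * (∏ i ∈ Finset.Icc 1 (t - 2), ((qval t : ℝ) - (i : ℝ))) /
    (qval t : ℝ) ^ (t - 1)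

section helpers
open Finset


theorem bonf (u : ℝ) (h0 : 0 ≤ u) (h1 : u ≤ 1) (n : ℕ) :
    (0 ≤ (1-u)^n ∧ (1-u)^n ≤ 1) ∧ 1 - n*u ≤ (1-u)^n ∧ (1-u)^n ≤ 1 - n*u + n*(n-1)/2*u^2 ∧
    1 - n*u + n*(n-1)/2*u^2 - n*(n-1)*(n-2)/6*u^3 ≤ (1-u)^n ∧
    (1-u)^n ≤ 1 - n*u + n*(n-1)/2*u^2 - n*(n-1)*(n-2)/6*u^3 + n*(n-1)*(n-2)*(n-3)/24*u^4 := by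
  induction n with
  | zero => norm_num
  | succ n ih =>
    obtain ⟨⟨a, b⟩, c, d, e, f⟩ := ih
    have hp : (1-u)^(n+1) = (1-u)^n - u*(1-u)^n := by ring
    rw [hp]
    have b' := mul_le_mul_of_nonneg_left b h0
    have a' := mul_le_mul_of_nonneg_left a h0
    have c' := mul_le_mul_of_nonneg_left c h0
    have d' := mul_le_mul_of_nonneg_left d h0
    have e' := mul_le_mul_of_nonneg_left e h0
    push_cast
    refine ⟨⟨?_, ?_⟩, ?_, ?_, ?_, ?_⟩
    · nlinarith
    · nlinarith
    · nlinarith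
    · nlinarith
    · nlinarith
    · nlinarith

/-- step up -/
theorem step_up (t : ℕ) (ht : 4 ≤ t) (R : ℝ) (hR : (t:ℝ) - 1 ≤ R) (hR1 : 6*R ≤ (t-1)*(3*t-2)) :
    (R - (t-1)) * R^(t-1) ≤ (R-1)^t := by
  have ht' : (4:ℝ) ≤ t := by exact_mod_cast ht
  have hRpos : 0 < R := by linarith
  have hu1 : 1/R ≤ 1 := by rw [div_le_one hRpos]; linarith
  obtain ⟨-, -, -, e, -⟩ := bonf (1/R) (by positivity) hu1 t
  have key : 1 - ((t:ℝ)-1)*(1/R) ≤ (1-1/R)^t := by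
    refine le_trans ?_ e
    have hq : 0 ≤ -R^2 + t*(t-1)/2*R - t*(t-1)*(t-2)/6 := by
      have h1 : 0 ≤ (R - (t-1)) * ((t-1)*(3*t-2) - 6*R) :=
        mul_nonneg (by linarith) (by linarith)
      have h2 : 0 ≤ ((t:ℝ)-4)*(R-(t-1)) := mul_nonneg (by linarith) (by linarith)
      nlinarith [mul_nonneg (by linarith : (0:ℝ) ≤ t-4) (by linarith : (0:ℝ) ≤ t-4)]
    have : 1 - (t:ℝ)*(1/R) + t*(t-1)/2*(1/R)^2 - t*(t-1)*(t-2)/6*(1/R)^3 - (1 - ((t:ℝ)-1)*(1/R))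
      = (-R^2 + t*(t-1)/2*R - t*(t-1)*(t-2)/6) / R^3 := by
      field_simp; ring
    have := div_nonneg hq (by positivity : 0 ≤ R^3)
    linarith
  have h3 := mul_le_mul_of_nonneg_right key (by positivity : 0 ≤ R^t)
  have h4 : (1-1/R)^t * R^t = (R-1)^t := by
    rw [← mul_pow]; congr 1; field_simp
  rw [h4] at h3
  obtain ⟨s, rfl⟩ : ∃ s, t = s+1 := ⟨t-1, by omega⟩
  refine le_trans (le_of_eq ?_) h3
  simp only [Nat.add_sub_cancel, pow_succ]
  field_simp

theorem step_down (t : ℕ) (ht : 4 ≤ t) (R : ℝ) (hR1 : (3*t^2-5*t+4 : ℝ) ≤ 6*R) :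
    (R-1)^t ≤ (R - (t-1)) * R^(t-1) := by
  have ht' : (4:ℝ) ≤ t := by exact_mod_cast ht
  have hRpos : 1 < R := by nlinarith
  have hu1 : 1/R ≤ 1 := by rw [div_le_one (by linarith)]; linarith
  obtain ⟨-, -, -, -, f⟩ := bonf (1/R) (by positivity) hu1 t
  have key : (1-1/R)^t ≤ 1 - ((t:ℝ)-1)*(1/R) := by
    refine le_trans f ?_
    have hq : R*(R*(t*(t-1)/2 - R) - t*(t-1)*(t-2)/6) + t*(t-1)*(t-2)*(t-3)/24 ≤ 0 := by
      have h1 : R*(t*(t-1)/2 - R) - t*(t-1)*(t-2)/6 ≤ -((t:ℝ)-2)^2/9 := by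
        obtain ⟨d, hd⟩ : ∃ d : ℝ, R = (3*t^2-5*t+4)/6 + d := ⟨R - (3*t^2-5*t+4)/6, by ring⟩
        have hd0 : 0 ≤ d := by linarith
        rw [hd]
        nlinarith [mul_nonneg hd0 (by nlinarith : (0:ℝ) ≤ 3*t^2-7*t+8)]
      have h2 := mul_le_mul_of_nonneg_left h1 (by linarith : 0 ≤ R)
      have h3 : (3*t^2-5*t+4)/6 * (t-2)^2/9 ≤ R*((t:ℝ)-2)^2/9 := by
        have := mul_le_mul_of_nonneg_right hR1 (sq_nonneg ((t:ℝ)-2))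
        linarith
      have h4 : t*(t-1)*(t-2)*(t-3)/24 ≤ (3*(t:ℝ)^2-5*t+4)/6 * (t-2)^2/9 := by
        have : 0 ≤ ((t:ℝ)-2) * (3*t^3-8*t^2+29*t-32) := by
          apply mul_nonneg (by linarith)
          nlinarith [mul_nonneg (by linarith : (0:ℝ) ≤ t-4) (sq_nonneg (t:ℝ))]
        nlinarith
      linarith
    have h5 : 1 - (t:ℝ)*(1/R) + t*(t-1)/2*(1/R)^2 - t*(t-1)*(t-2)/6*(1/R)^3 + t*(t-1)*(t-2)*(t-3)/24*(1/R)^4 - (1 - ((t:ℝ)-1)*(1/R))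
      = (R*(R*(t*(t-1)/2 - R) - t*(t-1)*(t-2)/6) + t*(t-1)*(t-2)*(t-3)/24) / R^4 := by
      field_simp; ring
    have := div_nonpos_of_nonpos_of_nonneg hq (by positivity : 0 ≤ R^4)
    linarith
  have h3 := mul_le_mul_of_nonneg_right key (by positivity : 0 ≤ R^t)
  have h4 : (1-1/R)^t * R^t = (R-1)^t := by
    rw [← mul_pow]; congr 1; field_simp
  rw [h4] at h3
  obtain ⟨s, rfl⟩ : ∃ s, t = s+1 := ⟨t-1, by omega⟩
  refine le_trans h3 (le_of_eq ?_)
  simp only [Nat.add_sub_cancel, pow_succ]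
  field_simp

noncomputable def gg (k r : ℕ) : ℝ := (∏ i ∈ Finset.Icc 1 k, ((r : ℝ) - (i : ℝ))) / (r : ℝ) ^ (k+1)

theorem gg_zero (k r : ℕ) (h1 : 1 ≤ r) (h : r ≤ k) : gg k r = 0 := by
  unfold gg
  rw [Finset.prod_eq_zero (i := r) (by simp; omega) (by simp)]; simp

theorem gg_prod_pos (k r : ℕ) (h : k < r) : 0 < ∏ i ∈ Finset.Icc 1 k, ((r : ℝ) - (i : ℝ)) := by
  apply Finset.prod_pos
  intro i hi
  simp at hi
  have : (i:ℝ) < r := by exact_mod_cast (by omega)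
  linarith

theorem gg_nonneg (k r : ℕ) : 0 ≤ gg k (r+1) := by
  by_cases h : r + 1 ≤ k
  · rw [gg_zero k _ (by omega) h]
  · exact div_nonneg (gg_prod_pos k _ (by omega)).le (by positivity)

theorem gg_prod_succ (k r : ℕ) :
    (∏ i ∈ Finset.Icc 1 k, (((r+1 : ℕ) : ℝ) - (i : ℝ))) * ((r:ℝ) - k)
      = r * ∏ i ∈ Finset.Icc 1 k, ((r : ℝ) - (i : ℝ)) := by
  induction k with
  | zero => simp
  | succ k ih =>
    rw [Finset.prod_Icc_succ_top (by omega), Finset.prod_Icc_succ_top (by omega)]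
    push_cast at *
    linear_combination (r - k - 1 : ℝ) * ih

theorem gg_up (k r : ℕ) (hk : 2 ≤ k) (h1 : 1 ≤ r) (h : 6*((r:ℝ)+1) ≤ (k+1)*(3*k+4)) : gg k r ≤ gg k (r+1) := by
  by_cases hr : r ≤ k
  · rw [gg_zero k r h1 hr]; exact gg_nonneg k r
  push Not at hr
  have hr' : (k:ℝ) + 1 ≤ r := by exact_mod_cast hr
  have hs := step_up (k+2) (by omega) ((r:ℝ)+1) (by push_cast; linarith) (by push_cast; linarith)
  have hp := gg_prod_pos k r hr
  have e := gg_prod_succ k r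
  unfold gg
  set P := ∏ i ∈ Finset.Icc 1 k, ((r : ℝ) - (i : ℝ))
  set P' := ∏ i ∈ Finset.Icc 1 k, (((r+1:ℕ) : ℝ) - (i : ℝ))
  have e2 : P' = r * P / (r-k) := by rw [eq_div_iff (by linarith)]; exact e
  rw [e2]
  have hrk : (0:ℝ) < r - k := by linarith
  have hr0 : (0:ℝ) < r := by exact_mod_cast h1
  rw [div_div, div_le_div_iff₀ (by positivity) (by positivity)]
  push_cast at hs ⊢
  have : ((r:ℝ) - k) * (r+1)^(k+1) ≤ r^(k+2) := by
    convert hs using 2 <;> ring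
  calc P * ((r-k) * ((r:ℝ)+1)^(k+1)) ≤ P * r^(k+2) := mul_le_mul_of_nonneg_left this hp.le
    _ = _ := by ring

theorem gg_down (k r : ℕ) (hk : 2 ≤ k) (h : (3*k^2+7*k+6:ℝ) ≤ 6*((r:ℝ)+1)) : gg k (r+1) ≤ gg k r := by
  have hk' : (2:ℝ) ≤ k := by exact_mod_cast hk
  have hrk : (0:ℝ) < r - k := by nlinarith
  have hr0 : (0:ℝ) < r := by linarith
  have hr : k < r := by exact_mod_cast (by linarith : (k:ℝ) < r)
  have hs := step_down (k+2) (by omega) ((r:ℝ)+1) (by push_cast; linarith)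
  have hp := gg_prod_pos k r hr
  have e := gg_prod_succ k r
  unfold gg
  set P := ∏ i ∈ Finset.Icc 1 k, ((r : ℝ) - (i : ℝ))
  set P' := ∏ i ∈ Finset.Icc 1 k, (((r+1:ℕ) : ℝ) - (i : ℝ))
  have e2 : P' = r * P / (r-k) := by rw [eq_div_iff (by linarith)]; exact e
  rw [e2]
  rw [div_div, div_le_div_iff₀ (by positivity) (by positivity)]
  push_cast at hs ⊢
  have : r^(k+2) ≤ ((r:ℝ) - k) * (r+1)^(k+1) := by
    convert hs using 2 <;> ring
  calc _ = P * r^(k+2) := by ring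
    _ ≤ P * ((r-k) * ((r:ℝ)+1)^(k+1)) := mul_le_mul_of_nonneg_left this hp.le

theorem gg_max (k q : ℕ) (hk : 2 ≤ k) (h1 : 3*k^2+7*k ≤ 6*q) (h2 : 6*q ≤ (k+1)*(3*k+4))
    (r : ℕ) (hr : 1 ≤ r) : gg k r ≤ gg k q := by
  rcases le_total r q with h | h
  · obtain ⟨d, rfl⟩ := Nat.exists_eq_add_of_le h
    clear h h1
    induction d with
    | zero => simp
    | succ d ih =>
      refine (ih (by omega)).trans ?_
      apply gg_up k (r+d) hk (by omega)
      have : ((6*(r+(d+1)):ℕ):ℝ) ≤ (((k+1)*(3*k+4) :ℕ):ℝ) := by exact_mod_cast h2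
      push_cast at this ⊢; linarith
  · obtain ⟨d, rfl⟩ := Nat.exists_eq_add_of_le h
    clear h hr
    induction d with
    | zero => simp
    | succ d ih =>
      refine le_trans ?_ ih
      apply gg_down k (q+d) hk
      have : ((3*k^2+7*k:ℕ):ℝ) ≤ ((6*q :ℕ):ℝ) := by exact_mod_cast h1
      push_cast at this ⊢
      have : (0:ℝ) ≤ d := by positivity
      linarith

theorem gg_choose (k r : ℕ) (hr : 1 ≤ r) :
    (k.factorial : ℝ) * ((r.choose k : ℝ) * ((r:ℝ) - k) / (r:ℝ)^(k+2)) = gg k r := by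
  have h : ∀ k : ℕ, (k.factorial : ℝ) * ((r.choose k : ℝ) * ((r:ℝ) - k)) = r * ∏ i ∈ Finset.Icc 1 k, ((r : ℝ) - (i : ℝ)) := by
    intro k
    induction k with
    | zero => simp
    | succ k ih =>
      rw [Finset.prod_Icc_succ_top (by omega), ← mul_assoc (r:ℝ), ← ih]
      have : ((r.choose (k+1) : ℝ)) * (k+1) = r.choose k * ((r:ℝ) - k) := by
        rcases le_or_gt k r with hkr | hkr
        · have := Nat.choose_succ_right_eq r k
          have h2 : ((r.choose (k+1) * (k+1) : ℕ):ℝ) = ((r.choose k * (r-k) : ℕ) : ℝ) := by rw [this]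
          push_cast [Nat.cast_sub hkr] at h2
          exact h2
        · rw [Nat.choose_eq_zero_of_lt hkr, Nat.choose_eq_zero_of_lt (by omega)]; simp
      rw [Nat.factorial_succ]; push_cast
      linear_combination (k.factorial : ℝ) * (r - (k+1)) * this
  unfold gg
  have hr0 : (r:ℝ) ≠ 0 := by positivity
  rw [← mul_div_assoc, h k]
  field_simp
  ring


open Classical in
/-- common neighbourhood -/
noncomputable def cnb {V : Type*} [Fintype V] (G : SimpleGraph V) (K : Finset V) : Finset V :=
  univ.filter (fun u => ∀ w ∈ K, G.Adj w u)

open Classical in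
noncomputable def cliq {V : Type*} [Fintype V] (G : SimpleGraph V) (k : ℕ) : Finset (Finset V) :=
  univ.filter (fun K => G.IsNClique k K)

open Classical in
/-- the bilinear form of non-adjacent pairs -/
noncomputable def QB {V : Type*} [Fintype V] (G : SimpleGraph V) (K : Finset V) (x y : V → ℝ) : ℝ :=
  ∑ u ∈ cnb G K, ∑ v ∈ cnb G K, if G.Adj u v then 0 else x u * y v

noncomputable def DD {V : Type*} [Fintype V] (G : SimpleGraph V) (k : ℕ) (x : V → ℝ) : ℝ :=
  ∑ K ∈ cliq G k, (∏ w ∈ K, x w) * QB G K x x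

theorem QB_expand {V : Type*} [Fintype V] (G : SimpleGraph V) (K : Finset V) (x d : V → ℝ) (e : ℝ) :
    QB G K (fun v => x v + e * d v) (fun v => x v + e * d v)
      = QB G K x x + e * (QB G K x d + QB G K d x) + e^2 * QB G K d d := by
  classical
  unfold QB
  simp only [← Finset.sum_add_distrib, Finset.mul_sum]
  refine Finset.sum_congr rfl fun u _ => Finset.sum_congr rfl fun v _ => ?_
  split_ifs <;> ring

theorem QB_congr {V : Type*} [Fintype V] (G : SimpleGraph V) (K : Finset V) (x y : V → ℝ)
    (h : ∀ v ∈ cnb G K, x v = y v) : QB G K x x = QB G K y y := by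
  classical
  unfold QB
  refine Finset.sum_congr rfl fun u hu => Finset.sum_congr rfl fun v hv => ?_
  rw [h u hu, h v hv]

open Classical in
noncomputable def dir {V : Type*} (a b : V) : V → ℝ := fun v => (if v = b then 1 else 0) - (if v = a then 1 else 0)

theorem QB_dir {V : Type*} [Fintype V] (G : SimpleGraph V) (K : Finset V) (a b : V) (hab : a ≠ b)
    (hn : ¬ G.Adj a b) : 0 ≤ QB G K (dir a b) (dir a b) := by
  classical
  have hn' : ¬ G.Adj b a := fun h => hn h.symm
  have : QB G K (dir a b) (dir a b) = ((if b ∈ cnb G K then 1 else 0) - (if a ∈ cnb G K then 1 else 0))^2 := by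
    have h1 : QB G K (dir a b) (dir a b) = ∑ u ∈ cnb G K, ∑ v ∈ cnb G K, dir a b u * dir a b v := by
      unfold QB
      refine Finset.sum_congr rfl fun u hu => Finset.sum_congr rfl fun v hv => ?_
      split_ifs with h
      · unfold dir
        by_cases u1 : u = a <;> by_cases u2 : u = b <;> by_cases v1 : v = a <;> by_cases v2 : v = b <;>
          simp_all
      · rfl
    rw [h1, ← Finset.sum_mul_sum, ← sq]
    congr 1
    unfold dir
    rw [Finset.sum_sub_distrib, Finset.sum_ite_eq', Finset.sum_ite_eq']
  rw [this]; positivity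

theorem prod_dir {V : Type*} [Fintype V] (K : Finset V) (a b : V) (hab : a ≠ b) (hn : ¬ (a ∈ K ∧ b ∈ K))
   (x : V → ℝ) : ∃ P L : ℝ, ∀ e : ℝ, ∏ w ∈ K, (x w + e * dir a b w) = P + e * L := by
  classical
  by_cases ha : a ∈ K
  · have hb : b ∉ K := fun h => hn ⟨ha, h⟩
    refine ⟨x a * ∏ w ∈ K.erase a, x w, - ∏ w ∈ K.erase a, x w, fun e => ?_⟩
    rw [← Finset.mul_prod_erase _ _ ha]
    have : ∏ w ∈ K.erase a, (x w + e * dir a b w) = ∏ w ∈ K.erase a, x w := by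
      refine Finset.prod_congr rfl fun w hw => ?_
      have h1 : w ≠ a := Finset.ne_of_mem_erase hw
      have h2 : w ≠ b := fun h => hb (h ▸ Finset.mem_of_mem_erase hw)
      simp [dir, h1, h2]
    rw [this]; simp [dir, hab]; ring
  by_cases hb : b ∈ K
  · refine ⟨x b * ∏ w ∈ K.erase b, x w, ∏ w ∈ K.erase b, x w, fun e => ?_⟩
    rw [← Finset.mul_prod_erase _ _ hb]
    have : ∏ w ∈ K.erase b, (x w + e * dir a b w) = ∏ w ∈ K.erase b, x w := by
      refine Finset.prod_congr rfl fun w hw => ?_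
      have h1 : w ≠ b := Finset.ne_of_mem_erase hw
      have h2 : w ≠ a := fun h => ha (h ▸ Finset.mem_of_mem_erase hw)
      simp [dir, h1, h2]
    rw [this]; simp [dir, hab.symm]; ring
  · refine ⟨∏ w ∈ K, x w, 0, fun e => ?_⟩
    rw [mul_zero, add_zero]
    refine Finset.prod_congr rfl fun w hw => ?_
    have h1 : w ≠ b := fun h => hb (h ▸ hw)
    have h2 : w ≠ a := fun h => ha (h ▸ hw)
    simp [dir, h1, h2]

/-- convexity along a non-adjacent pair -/
theorem DD_convex {V : Type*} [Fintype V] (G : SimpleGraph V) (k : ℕ) (x : V → ℝ) (hx : ∀ v, 0 ≤ x v)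
    (a b : V) (hab : a ≠ b) (hn : ¬ G.Adj a b) :
    (x a + x b) * DD G k x ≤ x b * DD G k (fun v => x v + x a * dir a b v)
      + x a * DD G k (fun v => x v + (- x b) * dir a b v) := by
  classical
  unfold DD
  rw [Finset.mul_sum, Finset.mul_sum, Finset.mul_sum, ← Finset.sum_add_distrib]
  refine Finset.sum_le_sum fun K hK => ?_
  have hK' : G.IsNClique k K := by simpa [cliq] using hK
  have hnK : ¬ (a ∈ K ∧ b ∈ K) := fun h => hn (hK'.1 h.1 h.2 hab)
  have hn' : ¬ G.Adj b a := fun h => hn h.symm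
  by_cases hK2 : a ∈ K ∨ b ∈ K
  · obtain ⟨P, L, hPL⟩ := prod_dir K a b hab hnK x
    have hQ : ∀ e : ℝ, QB G K (fun v => x v + e * dir a b v) (fun v => x v + e * dir a b v) = QB G K x x := by
      intro e
      refine QB_congr G K _ _ fun v hv => ?_
      have hv' : ∀ w ∈ K, G.Adj w v := by simpa [cnb] using hv
      have h1 : v ≠ a := by
        rintro rfl
        rcases hK2 with h | h
        · exact G.loopless.irrefl _ (hv' _ h)
        · exact hn' (hv' _ h)
      have h2 : v ≠ b := by
        rintro rfl
        rcases hK2 with h | h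
        · exact hn (hv' _ h)
        · exact G.loopless.irrefl _ (hv' _ h)
      simp [dir, h1, h2]
    have h0 := hPL 0
    simp only [zero_mul, add_zero] at h0
    rw [hQ, hQ, hPL, hPL, h0]
    apply le_of_eq; ring
  · push Not at hK2
    have hP : ∀ e : ℝ, ∏ w ∈ K, (x w + e * dir a b w) = ∏ w ∈ K, x w := by
      intro e
      refine Finset.prod_congr rfl fun w hw => ?_
      have h1 : w ≠ b := fun h => hK2.2 (h ▸ hw)
      have h2 : w ≠ a := fun h => hK2.1 (h ▸ hw)
      simp [dir, h1, h2]
    rw [hP, hP, QB_expand, QB_expand]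
    have hp : 0 ≤ ∏ w ∈ K, x w := Finset.prod_nonneg fun w _ => hx w
    have hd := QB_dir G K a b hab hn
    have : 0 ≤ (∏ w ∈ K, x w) * QB G K (dir a b) (dir a b) * (x a * x b * (x a + x b)) := by
      have := hx a; have := hx b
      positivity
    nlinarith

/-- complete graph version on a finset -/
noncomputable def ee {V : Type*} (x : V → ℝ) (S : Finset V) (k : ℕ) : ℝ :=
  ∑ K ∈ S.powersetCard k, ∏ w ∈ K, x w

open Classical in
noncomputable def DS {V : Type*} (x : V → ℝ) (S : Finset V) (k : ℕ) : ℝ :=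
  ∑ K ∈ S.powersetCard k, (∏ w ∈ K, x w) * ∑ u ∈ S \ K, x u ^ 2

theorem sum_psc_insert {V : Type*} [DecidableEq V] (S : Finset V) (a : V) (ha : a ∉ S) (k : ℕ)
    (f : Finset V → ℝ) : ∑ K ∈ (insert a S).powersetCard (k+1), f K
      = ∑ K ∈ S.powersetCard (k+1), f K + ∑ K ∈ S.powersetCard k, f (insert a K) := by
  rw [Finset.powersetCard_succ_insert ha, Finset.sum_union, Finset.sum_image]
  · intro K hK K' hK' h
    have h1 : a ∉ K := fun h => ha ((Finset.mem_powersetCard.1 hK).1 h)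
    have h2 : a ∉ K' := fun h => ha ((Finset.mem_powersetCard.1 hK').1 h)
    rw [← Finset.erase_insert h1, ← Finset.erase_insert h2, h]
  · rw [Finset.disjoint_left]
    intro K hK hK'
    obtain ⟨L, hL, rfl⟩ := Finset.mem_image.1 hK'
    exact ha ((Finset.mem_powersetCard.1 hK).1 (Finset.mem_insert_self _ _))

theorem ee_insert {V : Type*} [DecidableEq V] (x : V → ℝ) (S : Finset V) (a : V) (ha : a ∉ S) (k : ℕ) :
    ee x (insert a S) (k+1) = ee x S (k+1) + x a * ee x S k := by
  unfold ee
  rw [sum_psc_insert S a ha, Finset.mul_sum]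
  congr 1
  refine Finset.sum_congr rfl fun K hK => ?_
  rw [Finset.prod_insert fun h => ha ((Finset.mem_powersetCard.1 hK).1 h)]

theorem DS_insert {V : Type*} [DecidableEq V] (x : V → ℝ) (S : Finset V) (a : V) (ha : a ∉ S) (k : ℕ) :
    DS x (insert a S) (k+1) = DS x S (k+1) + x a ^ 2 * ee x S (k+1) + x a * DS x S k := by
  have hdd : DS x (insert a S) (k+1) = ∑ K ∈ (insert a S).powersetCard (k+1), (∏ w ∈ K, x w) * ∑ u ∈ insert a S \ K, x u ^ 2 := by
    unfold DS; congr!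
  have hdd2 : ∀ k, DS x S k = ∑ K ∈ S.powersetCard k, (∏ w ∈ K, x w) * ∑ u ∈ S \ K, x u ^ 2 := by
    intro k; unfold DS; congr!
  rw [hdd, hdd2, hdd2]
  unfold ee
  rw [sum_psc_insert S a ha, Finset.mul_sum, Finset.mul_sum, ← Finset.sum_add_distrib]
  congr 1
  · refine Finset.sum_congr rfl fun K hK => ?_
    have haK : a ∉ K := fun h => ha ((Finset.mem_powersetCard.1 hK).1 h)
    rw [Finset.insert_sdiff_of_notMem _ haK, Finset.sum_insert (by simp [ha])]
    ring
  · refine Finset.sum_congr rfl fun K hK => ?_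
    have haK : a ∉ K := fun h => ha ((Finset.mem_powersetCard.1 hK).1 h)
    rw [Finset.prod_insert haK, Finset.insert_sdiff_insert, Finset.sdiff_insert_of_notMem ha]
    ring

theorem DS_congr {V : Type*} (x y : V → ℝ) (S : Finset V) (h : ∀ v ∈ S, x v = y v) (k : ℕ) :
    DS x S k = DS y S k ∧ ee x S k = ee y S k := by
  classical
  have h1 : ∀ K ∈ S.powersetCard k, ∏ w ∈ K, x w = ∏ w ∈ K, y w := fun K hK =>
    Finset.prod_congr rfl fun w hw => h w ((Finset.mem_powersetCard.1 hK).1 hw)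
  refine ⟨?_, Finset.sum_congr rfl h1⟩
  refine Finset.sum_congr rfl fun K hK => ?_
  rw [h1 K hK]
  congr 1
  exact Finset.sum_congr rfl fun u hu => by rw [h u (Finset.mem_sdiff.1 hu).1]

/-- linear in the product -/
theorem DS_pair {V : Type*} (x : V → ℝ) (S : Finset V) (a b : V) (hab : a ≠ b) (ha : a ∈ S) (hb : b ∈ S) (k : ℕ)
    (hk : 2 ≤ k) : ∃ A B : ℝ, ∀ y : V → ℝ, (∀ v, v ≠ a → v ≠ b → y v = x v) → y a + y b = x a + x b →
      DS y S k = A + B * (y a * y b) := by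
  classical
  obtain ⟨k, rfl⟩ := Nat.exists_eq_add_of_le' hk
  obtain ⟨R, hRa, hRb, rfl⟩ : ∃ R : Finset V, a ∉ insert b R ∧ b ∉ R ∧ S = insert a (insert b R) := by
    refine ⟨(S.erase a).erase b, by simp [hab], by simp, ?_⟩
    rw [Finset.insert_erase (by simp [hab.symm, hb]), Finset.insert_erase ha]
  have hRa' : a ∉ R := fun h => hRa (Finset.mem_insert_of_mem h)
  refine ⟨DS x R (k+2) + (x a + x b)^2 * ee x R (k+2) + (x a + x b) * DS x R (k+1),
    -2 * ee x R (k+2) + (x a + x b) * ee x R (k+1) + DS x R k, fun y hy hs => ?_⟩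
  have hc : ∀ v ∈ R, y v = x v := fun v hv => hy v (fun h => hRa' (h ▸ hv)) (fun h => hRb (h ▸ hv))
  rw [DS_insert _ _ _ hRa, DS_insert _ _ _ hRb, ee_insert _ _ _ hRb, DS_insert _ _ _ hRb]
  have h1 := fun j => (DS_congr y x R hc j).1
  have h2 := fun j => (DS_congr y x R hc j).2
  rw [h1, h1, h1, h2, h2, ← hs]
  ring

theorem DD_clique {V : Type*} [Fintype V] (G : SimpleGraph V) (k : ℕ) (x : V → ℝ) (S : Finset V)
    (hS : G.IsClique S) (hx : ∀ v, v ∉ S → x v = 0) : DD G k x = DS x S k := by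
  classical
  unfold DD DS
  symm
  have hsub : S.powersetCard k ⊆ cliq G k := by
    intro K hK
    obtain ⟨h1, h2⟩ := Finset.mem_powersetCard.1 hK
    simp only [cliq, Finset.mem_filter, Finset.mem_univ, true_and]
    exact ⟨hS.subset (by exact_mod_cast h1), h2⟩
  rw [← Finset.sum_subset hsub]
  · refine Finset.sum_congr (by congr!) fun K hK => ?_
    obtain ⟨h1, h2⟩ := Finset.mem_powersetCard.1 hK
    congr 1
    have hss : S \ K ⊆ cnb G K := by
      intro u hu
      obtain ⟨hu1, hu2⟩ := Finset.mem_sdiff.1 hu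
      simp only [cnb, Finset.mem_filter, Finset.mem_univ, true_and]
      exact fun w hw => hS (h1 hw) hu1 (fun h => hu2 (h ▸ hw))
    unfold QB
    rw [← Finset.sum_subset hss]
    · refine Finset.sum_congr rfl fun u hu => ?_
      rw [Finset.sum_eq_single u]
      · simp [sq]
      · intro v hv hvu
        split_ifs with hadj
        · rfl
        · have : v ∉ S := fun hvS => hadj (hS (Finset.mem_sdiff.1 hu).1 hvS hvu.symm)
          rw [hx v this, mul_zero]
      · intro h; exact absurd (hss hu) h
    · intro u hu huS
      have huK : u ∉ K := by
        intro h
        have hv' : ∀ w ∈ K, G.Adj w u := by simpa [cnb] using hu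
        exact G.loopless.irrefl _ (hv' _ h)
      have : u ∉ S := fun h => huS (Finset.mem_sdiff.2 ⟨h, huK⟩)
      apply Finset.sum_eq_zero
      intro v _
      rw [hx u this]; simp
  · intro K hK hKS
    have hK' : G.IsNClique k K := by simpa [cliq] using hK
    have : ¬ K ⊆ S := fun h => hKS (Finset.mem_powersetCard.2 ⟨h, hK'.2⟩)
    obtain ⟨w, hw, hwS⟩ := Finset.not_subset.1 this
    rw [Finset.prod_eq_zero hw (hx w hwS), zero_mul]

theorem DS_const {V : Type*} (x : V → ℝ) (S : Finset V) (c : ℝ) (h : ∀ v ∈ S, x v = c) (k : ℕ) :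
    DS x S k = (S.card.choose k : ℝ) * ((S.card : ℝ) - k) * c^(k+2) := by
  classical
  rw [(DS_congr x (fun _ => c) S h k).1]
  unfold DS
  have : ∀ K ∈ S.powersetCard k, (∏ w ∈ K, c) * ∑ u ∈ S \ K, c ^ 2 = ((S.card : ℝ) - k) * c^(k+2) := by
    intro K hK
    obtain ⟨h1, h2⟩ := Finset.mem_powersetCard.1 hK
    rw [Finset.prod_const, Finset.sum_const, Finset.card_sdiff_of_subset h1, h2, nsmul_eq_mul,
      Nat.cast_sub (h2 ▸ Finset.card_le_card h1)]
    ring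
  rw [Finset.sum_congr rfl this, Finset.sum_const, Finset.card_powersetCard, nsmul_eq_mul]
  ring

theorem DD_cont {V : Type*} [Fintype V] (G : SimpleGraph V) (k : ℕ) : Continuous (DD G k) := by
  classical
  unfold DD QB
  refine continuous_finsetSum _ fun K _ => Continuous.mul (by fun_prop) ?_
  refine continuous_finsetSum _ fun u _ => continuous_finsetSum _ fun v _ => ?_
  split_ifs <;> fun_prop

open Classical in
noncomputable def supp {V : Type*} [Fintype V] (x : V → ℝ) : Finset V := univ.filter (fun v => x v ≠ 0)

theorem shift_mem {V : Type*} [Fintype V] (x : V → ℝ) (hx : x ∈ stdSimplex ℝ V) (a b : V) (hab : a ≠ b)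
   (e : ℝ) (h1 : e ≤ x a) (h2 : - e ≤ x b) : (fun v => x v + e * dir a b v) ∈ stdSimplex ℝ V := by
  classical
  refine ⟨fun v => ?_, ?_⟩
  · have := hx.1 v
    unfold dir
    by_cases h : v = a
    · subst h; simp [hab]; linarith
    · by_cases h' : v = b
      · subst h'; simp [hab.symm]; linarith
      · simp [h, h', this]
  · rw [Finset.sum_add_distrib, hx.2, ← Finset.mul_sum]
    unfold dir
    rw [Finset.sum_sub_distrib]; simp

theorem shift_supp {V : Type*} [Fintype V] (x : V → ℝ) (a b : V) (hab : a ≠ b) (ha : x a ≠ 0) (hb : x b ≠ 0) :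
    (supp (fun v => x v + x a * dir a b v)).card < (supp x).card := by
  classical
  apply Finset.card_lt_card
  rw [Finset.ssubset_iff_of_subset]
  · exact ⟨a, by simp [supp, ha], by
      simp only [supp, Finset.mem_filter, Finset.mem_univ, true_and, not_not]; simp [dir, hab]⟩
  · intro v hv
    simp only [supp, Finset.mem_filter, Finset.mem_univ, true_and] at hv ⊢
    intro h
    apply hv
    have h1 : v ≠ a := by rintro rfl; exact ha h
    have h2 : v ≠ b := by rintro rfl; exact hb h
    simp [dir, h1, h2, h]

theorem DD_bound {V : Type*} [Fintype V] (G : SimpleGraph V) (k : ℕ) (hk : 2 ≤ k) (M : ℝ)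
    (hM : ∀ r : ℕ, 1 ≤ r → (r.choose k : ℝ) * ((r:ℝ) - k) / (r:ℝ)^(k+2) ≤ M)
    (z : V → ℝ) (hz : z ∈ stdSimplex ℝ V) : DD G k z ≤ M := by
  classical
  obtain ⟨x0, hx0, hmax0⟩ := (isCompact_stdSimplex ℝ V).exists_isMaxOn ⟨z, hz⟩ (DD_cont G k).continuousOn
  have hex : ∃ n : ℕ, ∃ x, x ∈ stdSimplex ℝ V ∧ DD G k x0 ≤ DD G k x ∧ (supp x).card = n :=
    ⟨_, x0, hx0, le_rfl, rfl⟩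
  obtain ⟨x, hx, hxm, hxc⟩ := Nat.find_spec hex
  have hmin : ∀ y ∈ stdSimplex ℝ V, (supp y).card < (supp x).card → DD G k y < DD G k x0 := by
    intro y hy hc
    by_contra hcon
    push Not at hcon
    exact Nat.find_min hex (hxc ▸ hc) ⟨y, hy, hcon, rfl⟩
  have hmax : ∀ y ∈ stdSimplex ℝ V, DD G k y ≤ DD G k x := fun y hy => (hmax0 hy).trans hxm
  refine (hmax z hz).trans ?_
  have hpos : ∀ v ∈ supp x, 0 < x v := by
    intro v hv
    have : x v ≠ 0 := by simpa [supp] using hv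
    exact lt_of_le_of_ne (hx.1 v) this.symm
  have hclq : G.IsClique (supp x : Set V) := by
    intro a ha b hb hab
    by_contra hn
    have ha' := hpos a ha
    have hb' := hpos b hb
    have h1 := DD_convex G k x hx.1 a b hab hn
    have h2 := hmax _ (shift_mem x hx a b hab (- x b) (by linarith) (by linarith))
    have h3 := hmin _ (shift_mem x hx a b hab (x a) le_rfl (by linarith))
      (shift_supp x a b hab ha'.ne' hb'.ne')
    have h4 := mul_le_mul_of_nonneg_left h2 ha'.le
    have h5 := mul_lt_mul_of_pos_left (h3.trans_le hxm) hb'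
    linarith
  have hoff : ∀ v, v ∉ supp x → x v = 0 := by
    intro v hv
    by_contra h
    exact hv (by simp [supp, h])
  have heq : ∀ a ∈ supp x, ∀ b ∈ supp x, x a = x b := by
    intro a ha b hb
    by_contra hne
    have hab : a ≠ b := fun h => hne (h ▸ rfl)
    have ha' := hpos a ha
    have hb' := hpos b hb
    obtain ⟨A, B, hAB⟩ := DS_pair x (supp x) a b hab ha hb k hk
    have d1 : dir a b a = -1 := by simp [dir, hab]
    have d2 : dir a b b = 1 := by simp [dir, hab.symm]
    have hsh : ∀ e : ℝ, DD G k (fun v => x v + e * dir a b v) = A + B * ((x a - e) * (x b + e)) := by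
      intro e
      rw [DD_clique G k _ (supp x) hclq, hAB]
      · simp only [d1, d2]; ring
      · intro v h1 h2; simp [dir, h1, h2]
      · simp only [d1, d2]; ring
      · intro v hv
        have h1 : v ≠ a := by rintro rfl; exact hv ha
        have h2 : v ≠ b := by rintro rfl; exact hv hb
        simp [dir, h1, h2, hoff v hv]
    have hself : DD G k x = A + B * (x a * x b) := by
      have := hsh 0
      simpa using this
    have h2 := hmax _ (shift_mem x hx a b hab ((x a - x b)/2) (by linarith) (by linarith))
    have h3 := hmin _ (shift_mem x hx a b hab (x a) le_rfl (by linarith))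
      (shift_supp x a b hab ha'.ne' hb'.ne')
    have h3' := h3.trans_le hxm
    rw [hsh, hself] at h2 h3'
    have hBpos : 0 < B := by
      have : 0 < B * (x a * x b) := by simp at h3'; linarith
      exact pos_of_mul_pos_left this (by positivity)
    have : 0 < B * (x a - x b)^2 := mul_pos hBpos (by have := sub_ne_zero.2 hne; positivity)
    nlinarith
  have hsum : ∑ v ∈ supp x, x v = 1 := by
    rw [← hx.2]
    exact Finset.sum_subset (Finset.subset_univ _) fun v _ hv => hoff v hv
  have hne : (supp x).Nonempty := by
    rw [Finset.nonempty_iff_ne_empty]; intro h; rw [h] at hsum; simp at hsum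
  obtain ⟨a, ha⟩ := hne
  have hcard : 1 ≤ (supp x).card := Finset.card_pos.2 ⟨a, ha⟩
  have hxa : x a = 1 / ((supp x).card : ℝ) := by
    rw [Finset.sum_congr rfl (fun v hv => heq v hv a ha), Finset.sum_const, nsmul_eq_mul] at hsum
    have : ((supp x).card : ℝ) ≠ 0 := by positivity
    field_simp; linarith
  rw [DD_clique G k x (supp x) hclq hoff, DS_const x (supp x) (1/((supp x).card:ℝ)) (fun v hv => (heq v hv a ha).trans hxa)]
  refine le_trans (le_of_eq ?_) (hM _ hcard)
  rw [one_div, inv_pow]; rfl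

open Classical in
noncomputable def prs {n : ℕ} (G : SimpleGraph (Fin n)) (K : Finset (Fin n)) : Finset (Fin n × Fin n) :=
  univ.filter (fun p => p.1 < p.2 ∧ p.1 ∈ cnb G K ∧ p.2 ∈ cnb G K ∧ ¬ G.Adj p.1 p.2)

noncomputable def trip {n : ℕ} (G : SimpleGraph (Fin n)) (k : ℕ) : Finset (Σ _ : Finset (Fin n), Fin n × Fin n) :=
  (cliq G k).sigma (fun K => prs G K)

theorem card_trip {n : ℕ} (G : SimpleGraph (Fin n)) (k : ℕ) :
    (trip G k).card = ∑ K ∈ cliq G k, (prs G K).card := by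
  unfold trip; rw [Finset.card_sigma]

theorem Kminus_adj (t : ℕ) (i j : Fin t) : (Kminus t).Adj i j ↔ i ≠ j ∧ (2 ≤ i.val ∨ 2 ≤ j.val) := by
  unfold Kminus
  rw [SimpleGraph.fromRel_adj]; tauto

theorem mem_cnb {V : Type*} [Fintype V] (G : SimpleGraph V) (K : Finset V) (u : V) :
    u ∈ cnb G K ↔ ∀ w ∈ K, G.Adj w u := by simp [cnb]

theorem mem_cliq {V : Type*} [Fintype V] (G : SimpleGraph V) (K : Finset V) (k : ℕ) :
    K ∈ cliq G k ↔ G.IsNClique k K := by simp [cliq]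

theorem mem_prs {n : ℕ} (G : SimpleGraph (Fin n)) (K : Finset (Fin n)) (p : Fin n × Fin n) :
    p ∈ prs G K ↔ p.1 < p.2 ∧ p.1 ∈ cnb G K ∧ p.2 ∈ cnb G K ∧ ¬ G.Adj p.1 p.2 := by simp [prs]

theorem mem_trip {n : ℕ} (G : SimpleGraph (Fin n)) (k : ℕ) (p) :
    p ∈ trip G k ↔ G.IsNClique k p.1 ∧ p.2.1 < p.2.2 ∧ p.2.1 ∈ cnb G p.1 ∧ p.2.2 ∈ cnb G p.1 ∧ ¬ G.Adj p.2.1 p.2.2 := by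
  unfold trip
  rw [Finset.mem_sigma, mem_cliq, mem_prs]

theorem copy_exists {n : ℕ} (G : SimpleGraph (Fin n)) (k : ℕ) (s : Finset (Fin n))
    (e : G.induce (s : Set (Fin n)) ≃g Kminus (k+2)) :
    ∃ p ∈ trip G k, insert p.2.1 (insert p.2.2 p.1) = s := by
  have hadj : ∀ a b : (s : Set (Fin n)), G.Adj a b ↔ (e a ≠ e b ∧ (2 ≤ (e a).val ∨ 2 ≤ (e b).val)) := by
    intro a b
    rw [← Kminus_adj, e.map_adj_iff]; rfl
  have hcard : s.card = k+2 := by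
    have := Fintype.card_congr e.toEquiv
    simpa using this
  have gen : ∀ u v : (s : Set (Fin n)), (e u).val < 2 → (e v).val < 2 → (u : Fin n) < v →
      ∃ p ∈ trip G k, insert p.2.1 (insert p.2.2 p.1) = s := by
    intro u v hu hv huv
    have huv' : u ≠ v := fun h => by rw [h] at huv; exact lt_irrefl _ huv
    have heuv : e u ≠ e v := fun h => huv' (e.injective h)
    have hbig : ∀ w : (s : Set (Fin n)), w ≠ u → w ≠ v → 2 ≤ (e w).val := by
      intro w h1 h2
      have h1' : (e w).val ≠ (e u).val := fun h => h1 (e.injective (Fin.ext h))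
      have h2' : (e w).val ≠ (e v).val := fun h => h2 (e.injective (Fin.ext h))
      have h3' : (e u).val ≠ (e v).val := fun h => heuv (Fin.ext h)
      omega
    have hKmem : ∀ w ∈ (s.erase v.1).erase u.1, ∃ h : w ∈ (s : Set (Fin n)), 2 ≤ (e ⟨w, h⟩).val ∧ w ≠ u ∧ w ≠ v := by
      intro w hw
      simp only [Finset.mem_erase] at hw
      refine ⟨hw.2.2, hbig _ ?_ ?_, hw.1, hw.2.1⟩
      · intro h; exact hw.1 (congrArg Subtype.val h)
      · intro h; exact hw.2.1 (congrArg Subtype.val h)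
    have hus : u.1 ∈ s := u.2
    have hvs : v.1 ∈ s := v.2
    have hne : u.1 ≠ v.1 := ne_of_lt huv
    refine ⟨⟨(s.erase v.1).erase u.1, (u.1, v.1)⟩, ?_, ?_⟩
    · rw [mem_trip]
      refine ⟨⟨?_, ?_⟩, huv, ?_, ?_, ?_⟩
      · intro a ha b hb hab
        obtain ⟨ha1, ha2, _⟩ := hKmem a ha
        obtain ⟨hb1, hb2, _⟩ := hKmem b hb
        refine (hadj ⟨a, ha1⟩ ⟨b, hb1⟩).2 ⟨fun h => hab ?_, Or.inl ha2⟩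
        exact congrArg Subtype.val (e.injective h)
      · rw [Finset.card_erase_of_mem (by simp [hne, hus]), Finset.card_erase_of_mem hvs, hcard]; rfl
      · rw [mem_cnb]
        intro w hw
        obtain ⟨h1, h2, h3, h4⟩ := hKmem w hw
        refine (hadj ⟨w, h1⟩ u).2 ⟨fun h => h3 ?_, Or.inl h2⟩
        exact congrArg Subtype.val (e.injective h)
      · rw [mem_cnb]
        intro w hw
        obtain ⟨h1, h2, h3, h4⟩ := hKmem w hw
        refine (hadj ⟨w, h1⟩ v).2 ⟨fun h => h4 ?_, Or.inl h2⟩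
        exact congrArg Subtype.val (e.injective h)
      · intro h
        have := ((hadj u v).1 h).2
        omega
    · ext w
      simp only [Finset.mem_insert, Finset.mem_erase]
      constructor
      · rintro (rfl | rfl | h)
        · exact hus
        · exact hvs
        · exact h.2.2
      · intro h
        by_cases h1 : w = u.1
        · exact Or.inl h1
        · by_cases h2 : w = v.1
          · exact Or.inr (Or.inl h2)
          · exact Or.inr (Or.inr ⟨h1, h2, h⟩)
  have h0 : (e (e.symm 0)).val < 2 := by simp
  have h1 : (e (e.symm 1)).val < 2 := by simp
  have hne : (e.symm 0).1 ≠ (e.symm 1).1 := by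
    intro h
    have := e.symm.injective (Subtype.ext h)
    simp at this
  rcases lt_or_gt_of_ne hne with h | h
  · exact gen _ _ h0 h1 h
  · exact gen _ _ h1 h0 h

theorem copy_of_trip {n : ℕ} (G : SimpleGraph (Fin n)) (k : ℕ) (p) (hp : p ∈ trip G k) :
    Nonempty (G.induce ((insert p.2.1 (insert p.2.2 p.1) : Finset (Fin n)) : Set (Fin n)) ≃g Kminus (k+2)) := by
  obtain ⟨K, u, v⟩ := p
  rw [mem_trip] at hp
  obtain ⟨⟨hK, hKc⟩, huv, hu, hv, hnadj⟩ := hp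
  rw [mem_cnb] at hu hv
  dsimp only at *
  let f : Fin (k+2) → Fin n := Fin.cons u (Fin.cons v (K.orderEmbOfFin hKc))
  have hf0 : f 0 = u := rfl
  have hf1 : f (Fin.succ 0) = v := rfl
  have hf2 : ∀ i : Fin k, f i.succ.succ = K.orderEmbOfFin hKc i := fun i => rfl
  have hmem : ∀ i : Fin k, f i.succ.succ ∈ K := fun i => Finset.orderEmbOfFin_mem _ _ _
  have hadj : ∀ i j, G.Adj (f i) (f j) ↔ (Kminus (k+2)).Adj i j := by
    intro i j
    rw [Kminus_adj]
    cases i using Fin.cases with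
    | zero =>
      cases j using Fin.cases with
      | zero => simp
      | succ j =>
        cases j using Fin.cases with
        | zero => rw [hf0, hf1]; simp [hnadj]
        | succ j => 
          have := (hu _ (hmem j)).symm
          rw [hf0]
          simp only [this, true_iff]
          refine ⟨(Fin.succ_ne_zero _).symm, Or.inr ?_⟩
          simp only [Fin.val_succ]; omega
    | succ i =>
      cases i using Fin.cases with
      | zero =>
        cases j using Fin.cases with
        | zero =>
          have : ¬ G.Adj v u := fun h => hnadj h.symm
          rw [hf0, hf1]; simp [this]
        | succ j =>
          cases j using Fin.cases with
          | zero => simp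
          | succ j =>
            have := (hv _ (hmem j)).symm
            rw [hf1]
            simp only [this, true_iff]
            refine ⟨fun h => (Fin.succ_ne_zero _).symm (Fin.succ_injective _ h), Or.inr ?_⟩
            simp only [Fin.val_succ]; omega
      | succ i =>
        have h2 : 2 ≤ (i.succ.succ).val := by simp only [Fin.val_succ]; omega
        cases j using Fin.cases with
        | zero =>
          have := (hu _ (hmem i))
          rw [hf0]
          simp only [this, true_iff]
          exact ⟨(Fin.succ_ne_zero _), Or.inl h2⟩
        | succ j =>
          cases j using Fin.cases with
          | zero =>
            have := (hv _ (hmem i))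
            rw [hf1]
            simp only [this, true_iff]
            exact ⟨fun h => (Fin.succ_ne_zero _) (Fin.succ_injective _ h), Or.inl h2⟩
          | succ j =>
            constructor
            · intro h
              exact ⟨fun hh => h.ne (by rw [hh]), Or.inl h2⟩
            · rintro ⟨h, -⟩
              refine hK (hmem i) (hmem j) ?_
              rw [hf2, hf2]
              intro hh
              exact h (by rw [(K.orderEmbOfFin hKc).injective hh])
  have huK : u ∉ K := fun h => G.loopless.irrefl _ (hu u h)
  have hvK : v ∉ K := fun h => G.loopless.irrefl _ (hv v h)
  have hinj : Function.Injective f := by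
    rw [Fin.cons_injective_iff, Fin.cons_injective_iff]
    refine ⟨?_, ?_, (K.orderEmbOfFin hKc).injective⟩
    · rintro ⟨i, hi⟩
      cases i using Fin.cases with
      | zero => exact huv.ne hi.symm
      | succ i => exact huK (hi ▸ hmem i)
    · rintro ⟨i, hi⟩
      exact hvK (hi ▸ hmem i)
  have hfs : ∀ i, f i ∈ ((insert u (insert v K) : Finset (Fin n)) : Set (Fin n)) := by
    intro i
    rw [Finset.mem_coe]
    cases i using Fin.cases with
    | zero => rw [hf0]; simp
    | succ i =>
      cases i using Fin.cases with
      | zero => rw [hf1]; simp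
      | succ i => exact Finset.mem_insert_of_mem (Finset.mem_insert_of_mem (hmem i))
  let f' : Fin (k+2) → ((insert u (insert v K) : Finset (Fin n)) : Set (Fin n)) := fun i => ⟨f i, hfs i⟩
  have hbij : Function.Bijective f' := by
    rw [Fintype.bijective_iff_injective_and_card]
    refine ⟨fun i j h => hinj (congrArg Subtype.val h), ?_⟩
    have : (insert u (insert v K)).card = k+2 := by
      rw [Finset.card_insert_of_notMem (by simp [huv.ne, huK]), Finset.card_insert_of_notMem hvK, hKc]
    simp only [Fintype.card_fin, Finset.coe_sort_coe, Fintype.card_coe, this]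
  refine ⟨RelIso.symm ⟨Equiv.ofBijective f' hbij, ?_⟩⟩
  intro i j
  exact hadj i j

theorem trip_inj {n : ℕ} (G : SimpleGraph (Fin n)) (k : ℕ) : Set.InjOn
    (fun p : (Σ _ : Finset (Fin n), Fin n × Fin n) => insert p.2.1 (insert p.2.2 p.1)) (trip G k) := by
  rintro ⟨K, u, v⟩ hp ⟨K', u', v'⟩ hp' h
  rw [Finset.mem_coe, mem_trip] at hp hp'
  obtain ⟨⟨hK, hKc⟩, huv, hu, hv, hnadj⟩ := hp
  obtain ⟨⟨hK', hKc'⟩, huv', hu', hv', hnadj'⟩ := hp'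
  rw [mem_cnb] at hu hv hu' hv'
  dsimp only at *
  have huK : u ∉ K := fun h => G.loopless.irrefl _ (hu u h)
  have hvK : v ∉ K := fun h => G.loopless.irrefl _ (hv v h)
  have huK' : u' ∉ K' := fun h => G.loopless.irrefl _ (hu' u' h)
  have hvK' : v' ∉ K' := fun h => G.loopless.irrefl _ (hv' v' h)
  have huniq : ∀ a ∈ insert u' (insert v' K'), ∀ b ∈ insert u' (insert v' K'), a < b → ¬ G.Adj a b →
      a = u' ∧ b = v' := by
    intro a ha b hb hab hn
    simp only [Finset.mem_insert] at ha hb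
    rcases ha with rfl | rfl | ha <;> rcases hb with rfl | rfl | hb
    · exact absurd hab (lt_irrefl _)
    · exact ⟨rfl, rfl⟩
    · exact absurd (hu' _ hb).symm hn
    · exact absurd (hab.trans huv') (lt_irrefl _)
    · exact absurd hab (lt_irrefl _)
    · exact absurd (hv' _ hb).symm hn
    · exact absurd (hu' _ ha) hn
    · exact absurd (hv' _ ha) hn
    · exact absurd (hK' ha hb hab.ne) hn
  obtain ⟨rfl, rfl⟩ := huniq u (h ▸ by simp) v (h ▸ by simp) huv hnadj
  have : K = K' := by
    have e1 : K = ((insert u (insert v K)).erase u).erase v := by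
      rw [Finset.erase_insert (by simp [huv.ne, huK]), Finset.erase_insert hvK]
    have e2 : K' = ((insert u (insert v K')).erase u).erase v := by
      rw [Finset.erase_insert (by simp [huv.ne, huK']), Finset.erase_insert hvK']
    rw [e1, e2, h]
  subst this
  rfl

theorem inducedCount_eq {n : ℕ} (G : SimpleGraph (Fin n)) (k : ℕ) :
    inducedCount (Kminus (k+2)) G = (trip G k).card := by
  classical
  unfold inducedCount
  have : {s : Finset (Fin n) | Nonempty (G.induce (s : Set (Fin n)) ≃g Kminus (k+2))}
      = (((trip G k).image fun p => insert p.2.1 (insert p.2.2 p.1) : Finset (Finset (Fin n))) : Set (Finset (Fin n))) := by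
    ext s
    rw [Set.mem_ofPred_eq, Finset.coe_image, Set.mem_image]
    constructor
    · rintro ⟨e⟩
      exact copy_exists G k s e
    · rintro ⟨p, hp, rfl⟩
      exact copy_of_trip G k p hp
  rw [this, Set.ncard_coe_finset]
  exact Finset.card_image_of_injOn (trip_inj G k)

theorem two_prs {n : ℕ} (G : SimpleGraph (Fin n)) (K : Finset (Fin n)) :
    2 * ((prs G K).card : ℝ) ≤ QB G K (fun _ => 1) (fun _ => 1) := by
  classical
  have h : QB G K (fun _ => 1) (fun _ => 1) = 
     ((((cnb G K) ×ˢ (cnb G K)).filter (fun p => ¬ G.Adj p.1 p.2)).card : ℝ) := by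
    unfold QB
    rw [← Finset.sum_product', Finset.card_filter]
    push_cast
    refine Finset.sum_congr rfl fun p _ => ?_
    split_ifs <;> simp_all
  rw [h]
  have h2 : (prs G K).card + ((prs G K).image Prod.swap).card ≤ (((cnb G K) ×ˢ (cnb G K)).filter (fun p => ¬ G.Adj p.1 p.2)).card := by
    rw [← Finset.card_union_of_disjoint]
    · apply Finset.card_le_card
      intro p hp
      rw [Finset.mem_union, Finset.mem_image] at hp
      rw [Finset.mem_filter, Finset.mem_product]
      rcases hp with hp | ⟨p, hp, rfl⟩
      · rw [mem_prs] at hp; tauto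
      · rw [mem_prs] at hp
        exact ⟨⟨hp.2.2.1, hp.2.1⟩, fun h => hp.2.2.2 h.symm⟩
    · rw [Finset.disjoint_left]
      intro p hp hp'
      obtain ⟨p', hp2, rfl⟩ := Finset.mem_image.1 hp'
      rw [mem_prs] at hp hp2
      exact lt_irrefl _ (hp.1.trans hp2.1)
  rw [Finset.card_image_of_injective _ Prod.swap_injective] at h2
  rw [← two_mul] at h2
  exact_mod_cast h2

theorem DD_unif {n : ℕ} (hn : 0 < n) (G : SimpleGraph (Fin n)) (k : ℕ) :
    2 * ((trip G k).card : ℝ) ≤ (n:ℝ)^(k+2) * DD G k (fun _ => 1/(n:ℝ)) := by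
  classical
  rw [card_trip]
  unfold DD
  push_cast
  rw [Finset.mul_sum, Finset.mul_sum]
  refine Finset.sum_le_sum fun K hK => ?_
  rw [mem_cliq] at hK
  rw [Finset.prod_const, hK.2]
  have : QB G K (fun _ => 1/(n:ℝ)) (fun _ => 1/(n:ℝ)) = (1/(n:ℝ))^2 * QB G K (fun _ => 1) (fun _ => 1) := by
    unfold QB
    rw [Finset.mul_sum]
    refine Finset.sum_congr rfl fun u _ => ?_
    rw [Finset.mul_sum]
    refine Finset.sum_congr rfl fun v _ => ?_
    split_ifs
    · simp
    · ring
  rw [this]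
  refine (two_prs G K).trans (le_of_eq ?_)
  have : (n:ℝ) ≠ 0 := by positivity
  rw [pow_add, one_div, inv_pow]
  field_simp

/-- Turán graph -/
def Tur (n q : ℕ) : SimpleGraph (Fin n) where
  Adj u v := u.val % q ≠ v.val % q
  symm := ⟨fun _ _ h => h.symm⟩
  loopless := ⟨fun _ h => h rfl⟩

def vert (n q : ℕ) (hn : 0 < n) (c i : ℕ) : Fin n := ⟨(c + q * i) % n, Nat.mod_lt _ hn⟩

theorem vert_val {n q m c i : ℕ} (hn : 0 < n) (hm : q * m ≤ n) (hc : c < q) (hi : i < m) :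
    (vert n q hn c i).val = c + q * i := by
  have : q * (i+1) ≤ q * m := Nat.mul_le_mul_left _ hi
  rw [Nat.mul_succ] at this
  exact Nat.mod_eq_of_lt (by omega)

theorem vert_mod {n q m c i : ℕ} (hn : 0 < n) (hm : q * m ≤ n) (hc : c < q) (hi : i < m) :
    (vert n q hn c i).val % q = c := by
  rw [vert_val hn hm hc hi, Nat.add_mul_mod_self_left, Nat.mod_eq_of_lt hc]

theorem vert_div {n q m c i : ℕ} (hn : 0 < n) (hm : q * m ≤ n) (hc : c < q) (hi : i < m) :
    (vert n q hn c i).val / q = i := by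
  rw [vert_val hn hm hc hi, Nat.add_mul_div_left _ _ (by omega), Nat.div_eq_of_lt hc, zero_add]

theorem Tur_prs (n q m k : ℕ) (hn : 0 < n) (hm : q * m ≤ n) (K : Finset (Fin n)) (hK : K ∈ cliq (Tur n q) k) :
    (q - k) * (m.choose 2) ≤ (prs (Tur n q) K).card := by
  classical
  rw [mem_cliq] at hK
  let C := (range q) \ (K.image (fun v => v.val % q))
  have hC : q - k ≤ C.card := by
    have h1 := Finset.le_card_sdiff (K.image (fun v => v.val % q)) (range q)
    have h2 : (K.image (fun v => v.val % q)).card ≤ k := hK.2 ▸ Finset.card_image_le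
    rw [Finset.card_range] at h1
    change q - k ≤ ((range q) \ (K.image (fun v => v.val % q))).card
    omega
  let P := (range m ×ˢ range m).filter (fun p : ℕ × ℕ => p.1 < p.2)
  have hP : P.card = m.choose 2 := by
    have : P.card = ∑ j ∈ range m, j := by
      rw [Finset.card_filter, Finset.sum_product_right]
      refine Finset.sum_congr rfl fun j hj => ?_
      rw [← Finset.card_filter]
      have : (range m).filter (fun i => i < j) = range j := by
        ext i; simp at hj ⊢; omega
      rw [this, Finset.card_range]
    rw [this, Finset.sum_range_id, Nat.choose_two_right]
  rw [← hP]
  refine (Nat.mul_le_mul_right _ hC).trans ?_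
  rw [← Finset.card_product]
  have key : ∀ p ∈ C ×ˢ P, p.1 < q ∧ (∀ w ∈ K, w.val % q ≠ p.1) ∧ p.2.1 < p.2.2 ∧ p.2.1 < m ∧ p.2.2 < m := by
    intro p hp
    rw [Finset.mem_product, Finset.mem_sdiff, Finset.mem_filter, Finset.mem_product] at hp
    simp only [Finset.mem_range, Finset.mem_image, not_exists, not_and] at hp
    exact ⟨hp.1.1, hp.1.2, hp.2.2, hp.2.1.1, hp.2.1.2⟩
  refine Finset.card_le_card_of_injOn (fun p => (vert n q hn p.1 p.2.1, vert n q hn p.1 p.2.2)) ?_ ?_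
  · intro p hp
    obtain ⟨h1, h2, h3, h4, h5⟩ := key p hp
    rw [Finset.mem_coe, mem_prs, mem_cnb, mem_cnb]
    refine ⟨?_, ?_, ?_, ?_⟩
    · rw [Fin.lt_def, vert_val hn hm h1 h4, vert_val hn hm h1 h5]
      exact Nat.add_lt_add_left (Nat.mul_lt_mul_of_pos_left h3 (by omega)) _
    · intro w hw
      change _ % q ≠ _ % q
      rw [vert_mod hn hm h1 h4]; exact h2 w hw
    · intro w hw
      change _ % q ≠ _ % q
      rw [vert_mod hn hm h1 h5]; exact h2 w hw
    · change ¬ (_ % q ≠ _ % q)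
      rw [vert_mod hn hm h1 h4, vert_mod hn hm h1 h5]; simp
  · intro p hp p' hp' h
    obtain ⟨h1, h2, h3, h4, h5⟩ := key p hp
    obtain ⟨h1', h2', h3', h4', h5'⟩ := key p' hp'
    obtain ⟨e1, e2⟩ := Prod.mk.inj h
    have a1 := congrArg (fun v : Fin n => v.val % q) e1
    have a2 := congrArg (fun v : Fin n => v.val / q) e1
    have a3 := congrArg (fun v : Fin n => v.val / q) e2
    beta_reduce at a1 a2 a3
    rw [vert_mod hn hm h1 h4, vert_mod hn hm h1' h4'] at a1
    rw [vert_div hn hm h1 h4, vert_div hn hm h1' h4'] at a2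
    rw [vert_div hn hm h1 h5, vert_div hn hm h1' h5'] at a3
    exact Prod.ext a1 (Prod.ext a2 a3)

theorem Tur_cliq (n q m k : ℕ) (hn : 0 < n) (hm : q * m ≤ n) :
    q.choose k * m ^ k ≤ (cliq (Tur n q) k).card := by
  classical
  let W : Finset (Σ S : Finset ℕ, (∀ a ∈ S, ℕ)) :=
    ((range q).powersetCard k).sigma (fun S => S.pi (fun _ => range m))
  have hW : W.card = q.choose k * m ^ k := by
    rw [Finset.card_sigma]
    have : ∀ S ∈ (range q).powersetCard k, (S.pi (fun _ => range m)).card = m ^ k := by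
      intro S hS
      rw [Finset.card_pi, Finset.prod_const, Finset.card_range, (Finset.mem_powersetCard.1 hS).2]
    rw [Finset.sum_congr rfl this, Finset.sum_const, Finset.card_powersetCard, Finset.card_range,
      smul_eq_mul]
  have key : ∀ p ∈ W, p.1.card = k ∧ (∀ c ∈ p.1, c < q) ∧ ∀ c (h : c ∈ p.1), p.2 c h < m := by
    intro p hp
    rw [Finset.mem_sigma, Finset.mem_powersetCard, Finset.mem_pi] at hp
    exact ⟨hp.1.2, fun c hc => Finset.mem_range.1 (hp.1.1 hc), fun c h => Finset.mem_range.1 (hp.2 c h)⟩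
  rw [← hW]
  refine Finset.card_le_card_of_injOn
    (fun p => p.1.attach.image (fun c => vert n q hn c.1 (p.2 c.1 c.2))) ?_ ?_
  · intro p hp
    obtain ⟨h1, h2, h3⟩ := key p hp
    rw [Finset.mem_coe, mem_cliq]
    refine ⟨?_, ?_⟩
    · intro u hu v hv huv
      rw [Finset.mem_coe, Finset.mem_image] at hu hv
      obtain ⟨c, -, rfl⟩ := hu
      obtain ⟨c', -, rfl⟩ := hv
      change _ % q ≠ _ % q
      rw [vert_mod hn hm (h2 _ c.2) (h3 _ c.2), vert_mod hn hm (h2 _ c'.2) (h3 _ c'.2)]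
      intro h
      have : c = c' := Subtype.ext h
      exact huv (by rw [this])
    · rw [Finset.card_image_of_injective, Finset.card_attach, h1]
      intro c c' h
      have a1 := congrArg (fun v : Fin n => v.val % q) h
      dsimp only at a1
      rw [vert_mod hn hm (h2 _ c.2) (h3 _ c.2), vert_mod hn hm (h2 _ c'.2) (h3 _ c'.2)] at a1
      exact Subtype.ext a1
  · intro p hp p' hp' h
    obtain ⟨h1, h2, h3⟩ := key p hp
    obtain ⟨h1', h2', h3'⟩ := key p' hp'
    obtain ⟨S, f⟩ := p
    obtain ⟨S', f'⟩ := p'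
    dsimp only at *
    have hsub : ∀ c (hc : c ∈ S), ∃ hc' : c ∈ S', f c hc = f' c hc' := by
      intro c hc
      have hmem : vert n q hn c (f c hc) ∈ S'.attach.image (fun c => vert n q hn c.1 (f' c.1 c.2)) := by
        rw [← h]
        exact Finset.mem_image.2 ⟨⟨c, hc⟩, Finset.mem_attach _ _, rfl⟩
      obtain ⟨c', -, he⟩ := Finset.mem_image.1 hmem
      have a1 := congrArg (fun v : Fin n => v.val % q) he
      have a2 := congrArg (fun v : Fin n => v.val / q) he
      beta_reduce at a1 a2
      rw [vert_mod hn hm (h2 _ hc) (h3 _ hc), vert_mod hn hm (h2' _ c'.2) (h3' _ c'.2)] at a1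
      rw [vert_div hn hm (h2 _ hc) (h3 _ hc), vert_div hn hm (h2' _ c'.2) (h3' _ c'.2)] at a2
      obtain ⟨c', hc'⟩ := c'
      dsimp only at a1 a2
      subst a1
      exact ⟨hc', a2.symm⟩
    have hSS : S = S' := Finset.eq_of_subset_of_card_le (fun c hc => (hsub c hc).1) (by rw [h1, h1'])
    subst hSS
    congr 1
    funext c hc
    exact (hsub c hc).2

theorem Tur_count (n q m k : ℕ) (hn : 0 < n) (hm : q * m ≤ n) :
    (q.choose k * m ^ k) * ((q - k) * m.choose 2) ≤ inducedCount (Kminus (k+2)) (Tur n q) := by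
  rw [inducedCount_eq, card_trip]
  refine (Nat.mul_le_mul_right _ (Tur_cliq n q m k hn hm)).trans ?_
  rw [← smul_eq_mul]
  exact Finset.card_nsmul_le_sum _ _ _ fun K hK => Tur_prs n q m k hn hm K hK

theorem lim_choose (t : ℕ) : Filter.Tendsto (fun n : ℕ => (n:ℝ)^t / (n.choose t : ℝ)) Filter.atTop
    (nhds (t.factorial : ℝ)) := by
  have h0 : Filter.Tendsto (fun n : ℕ => (n.choose t : ℝ) / (n:ℝ)^t) Filter.atTop
      (nhds (1 / (t.factorial : ℝ))) := by
    induction t with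
    | zero => simp
    | succ t ih =>
      have h1 : Filter.Tendsto (fun n : ℕ => (n.choose t : ℝ) / (n:ℝ)^t * ((1 - (t:ℝ) * (1/(n:ℝ))) / (t+1)))
          Filter.atTop (nhds (1 / (t.factorial : ℝ) * ((1 - (t:ℝ) * 0) / (t+1)))) := by
        refine ih.mul (Filter.Tendsto.div_const (tendsto_const_nhds.sub (tendsto_const_nhds.mul ?_)) _)
        exact tendsto_one_div_atTop_nhds_zero_nat
      have e : 1 / (t.factorial : ℝ) * ((1 - (t:ℝ) * 0) / (t+1)) = 1 / ((t+1).factorial : ℝ) := by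
        rw [Nat.factorial_succ]; push_cast
        have : (t.factorial : ℝ) ≠ 0 := by positivity
        field_simp; ring
      rw [e] at h1
      refine h1.congr' ?_
      filter_upwards [Filter.eventually_ge_atTop (t+1)] with n hn
      have hn0 : (n:ℝ) ≠ 0 := by have : n ≠ 0 := by omega
                                 exact_mod_cast this
      have := Nat.choose_succ_right_eq n t
      have h2 : ((n.choose (t+1) * (t+1) : ℕ):ℝ) = ((n.choose t * (n-t) : ℕ) : ℝ) := by rw [this]
      push_cast [Nat.cast_sub (by omega : t ≤ n)] at h2
      have h3 : (n.choose (t+1) : ℝ) = n.choose t * ((n:ℝ) - t) / (t+1) := by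
        rw [eq_div_iff (by positivity)]; exact h2
      rw [h3, pow_succ]
      field_simp
  have h1 := h0.inv₀ (by positivity)
  simpa using h1

theorem lim_floor (q : ℕ) (hq : 0 < q) : Filter.Tendsto (fun n : ℕ => ((n / q : ℕ) : ℝ) / (n:ℝ)) Filter.atTop
    (nhds (1 / (q : ℝ))) := by
  have hq' : (0:ℝ) < q := by exact_mod_cast hq
  refine tendsto_of_tendsto_of_tendsto_of_le_of_le' (g := fun n : ℕ => 1/(q:ℝ) - 1/(n:ℝ)) (h := fun _ => 1/(q:ℝ)) ?_
    tendsto_const_nhds ?_ ?_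
  · simpa using (tendsto_const_nhds (x := 1/(q:ℝ))).sub (tendsto_one_div_atTop_nhds_zero_nat (𝕜 := ℝ))
  · filter_upwards [Filter.eventually_ge_atTop 1] with n hn
    have hn' : (0:ℝ) < n := by exact_mod_cast hn
    have h1 : n < q * (n / q + 1) := by
      have := Nat.lt_mul_div_succ n hq; exact this
    have h2 : (n:ℝ) < q * (((n/q : ℕ):ℝ) + 1) := by exact_mod_cast h1
    rw [le_div_iff₀ hn', sub_mul]
    have h3 : (n:ℝ)/q ≤ ((n/q : ℕ):ℝ) + 1 := by rw [div_le_iff₀ hq']; linarith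
    have h4 : 1 / (n:ℝ) * n = 1 := by field_simp
    have h5 : 1 / (q:ℝ) * n = n / q := by ring
    linarith
  · filter_upwards [Filter.eventually_ge_atTop 1] with n hn
    have hn' : (0:ℝ) < n := by exact_mod_cast hn
    rw [div_le_div_iff₀ hn' hq', one_mul]
    exact_mod_cast Nat.div_mul_le_self n q

theorem qval_bounds (k : ℕ) : 3*k^2+7*k ≤ 6*qval (k+2) ∧ 6*qval (k+2) ≤ (k+1)*(3*k+4) := by
  have e : (((k+2 : ℕ) : ℚ) - 2) * (3 * ((k+2:ℕ) : ℚ) + 1) / 6 = (k * (3*k+7)) / 6 := by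
    push_cast; ring
  have h1 : ((k:ℚ) * (3*k+7)) / 6 ≤ (qval (k+2) : ℚ) := by
    unfold qval; rw [e]; exact Nat.le_ceil _
  have h2 : (qval (k+2) : ℚ) < ((k:ℚ) * (3*k+7)) / 6 + 1 := by
    unfold qval; rw [e]; exact Nat.ceil_lt_add_one (by positivity)
  generalize qval (k+2) = q at *
  have h1' : 3*k^2+7*k ≤ 6*q := by
    have : ((3*k^2+7*k : ℕ):ℚ) ≤ ((6*q : ℕ):ℚ) := by push_cast; linarith
    exact_mod_cast this
  have h2' : 6*q < 3*k^2+7*k+6 := by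
    have : ((6*q : ℕ):ℚ) < ((3*k^2+7*k+6 : ℕ):ℚ) := by push_cast; linarith
    exact_mod_cast this
  refine ⟨h1', ?_⟩
  have h3 : (3*k^2+7*k) % 2 = 0 := by
    rcases Nat.even_or_odd' k with ⟨c, rfl | rfl⟩ <;> ring_nf <;> omega
  have h4 : (k+1)*(3*k+4) = 3*k^2+7*k+4 := by ring
  omega

theorem main_lim (k : ℕ) (hk : 2 ≤ k) : Filter.Tendsto
        (fun n : ℕ => ⨆ G : SimpleGraph (Fin n),
          (inducedCount (Kminus (k+2)) G : ℝ) / (n.choose (k+2) : ℝ))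
        Filter.atTop (nhds (indVal (k+2))) := by
  obtain ⟨hq1, hq2⟩ := qval_bounds k
  have hind : indVal (k+2) = ((k+2).choose 2 : ℝ) * gg k (qval (k+2)) := by
    unfold indVal gg
    rw [show k+2-2 = k by omega, show k+2-1 = k+1 by omega, mul_div_assoc]
  rw [hind]
  generalize qval (k+2) = q at *
  have hqk : k < q := by nlinarith
  have hq0 : 0 < q := by omega
  have hq0' : (0:ℝ) < q := by exact_mod_cast hq0
  have hmax := gg_max k q hk hq1 hq2
  have hch := gg_choose k q hq0
  set M : ℝ := (q.choose k : ℝ) * ((q:ℝ) - k) / (q:ℝ)^(k+2) with hMdef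
  have hkf : (0:ℝ) < k.factorial := by positivity
  have hM : ∀ r : ℕ, 1 ≤ r → (r.choose k : ℝ) * ((r:ℝ) - k) / (r:ℝ)^(k+2) ≤ M := by
    intro r hr
    have h := hmax r hr
    rw [← hch, ← gg_choose k r hr] at h
    exact le_of_mul_le_mul_left h hkf
  have hfac : ((k+2).choose 2 : ℝ) * gg k q = (k+2).factorial * (M/2) := by
    rw [← hch]
    have : (((k+2).choose 2 : ℕ):ℝ) = ((k:ℝ)+2)*(k+1)/2 := by
      rw [Nat.cast_choose_two]; push_cast; ring
    rw [this, Nat.factorial_succ, Nat.factorial_succ]; push_cast; ring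
  rw [hfac]
  have hlc := lim_choose (k+2)
  have hfl := lim_floor q hq0
  refine tendsto_of_tendsto_of_tendsto_of_le_of_le'
    (g := fun n : ℕ => (n:ℝ)^(k+2) / (n.choose (k+2) : ℝ) * ((q.choose k : ℝ) * ((q:ℝ)-k) *
      (((n / q : ℕ) : ℝ) / (n:ℝ))^k * ((((n / q : ℕ) : ℝ) / (n:ℝ)) * ((((n / q : ℕ) : ℝ) / (n:ℝ)) - 1/(n:ℝ)) / 2)))
    (h := fun n : ℕ => (n:ℝ)^(k+2) / (n.choose (k+2) : ℝ) * (M/2)) ?_ (hlc.mul_const _) ?_ ?_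
  · have : M/2 = (q.choose k : ℝ) * ((q:ℝ)-k) * (1/(q:ℝ))^k * ((1/(q:ℝ)) * ((1/(q:ℝ)) - 0) / 2) := by
      rw [hMdef, pow_add, one_div, inv_pow]; field_simp; ring
    rw [this]
    refine hlc.mul ((tendsto_const_nhds.mul (hfl.pow k)).mul ((hfl.mul (hfl.sub ?_)).div_const 2))
    exact tendsto_one_div_atTop_nhds_zero_nat
  · filter_upwards [Filter.eventually_ge_atTop (k+2)] with n hn
    have hn0 : 0 < n := by omega
    have hn0' : (0:ℝ) < n := by exact_mod_cast hn0
    have hb : BddAbove (Set.range fun G : SimpleGraph (Fin n) =>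
        (inducedCount (Kminus (k+2)) G : ℝ) / (n.choose (k+2) : ℝ)) := (Set.finite_range _).bddAbove
    refine le_trans ?_ (le_ciSup hb (Tur n q))
    have hc := Tur_count n q (n/q) k hn0 (Nat.mul_div_le n q)
    have hc' : (((q.choose k * (n/q) ^ k) * ((q - k) * (n/q).choose 2) : ℕ) : ℝ) ≤ inducedCount (Kminus (k+2)) (Tur n q) := by
      exact_mod_cast hc
    rw [Nat.cast_mul, Nat.cast_mul, Nat.cast_mul, Nat.cast_pow, Nat.cast_sub hqk.le, Nat.cast_choose_two] at hc'
    refine le_trans (le_of_eq ?_) (div_le_div_of_nonneg_right hc' (Nat.cast_nonneg _))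
    generalize ((n/q : ℕ):ℝ) = m
    rw [div_pow, pow_add]
    field_simp
  · filter_upwards [Filter.eventually_ge_atTop (k+2)] with n hn
    have hn0 : 0 < n := by omega
    have hn0' : (0:ℝ) < n := by exact_mod_cast hn0
    refine ciSup_le fun G => ?_
    rw [inducedCount_eq, div_mul_eq_mul_div]
    refine div_le_div_of_nonneg_right ?_ (Nat.cast_nonneg _)
    have h1 := DD_unif hn0 G k
    have h2 := DD_bound G k hk M hM (fun _ => 1/(n:ℝ)) ⟨fun _ => by positivity, by
      rw [Finset.sum_const, Finset.card_univ, Fintype.card_fin, nsmul_eq_mul]; field_simp⟩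
    have h3 := mul_le_mul_of_nonneg_left h2 (by positivity : 0 ≤ (n:ℝ)^(k+2))
    linarith

end helpers

/-- For every `t ≥ 4`, the inducibility of `K_t^-` (the limit of the maximum induced
`K_t^-`-density of `n`-vertex graphs) equals `C(t,2)·(q−1)⋯(q−(t−2))/q^{t−1}` with
`q = ⌈(t−2)(3t+1)/6⌉`; in particular `ind(K_4^-) = 72/125` and `ind(K_5^-) = 525/1024`. -/
theorem stmt10 :
    (∀ t : ℕ, 4 ≤ t →
      Filter.Tendsto
        (fun n : ℕ => ⨆ G : SimpleGraph (Fin n),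
          (inducedCount (Kminus t) G : ℝ) / (n.choose t : ℝ))
        Filter.atTop (nhds (indVal t))) ∧
    indVal 4 = 72 / 125 ∧ indVal 5 = 525 / 1024 := by
  refine ⟨fun t ht => ?_, ?_, ?_⟩
  · obtain ⟨k, rfl⟩ := Nat.exists_eq_add_of_le' (by omega : 2 ≤ t)
    exact main_lim k (by omega)
  · have h := qval_bounds 2
    have hq : qval 4 = 5 := by norm_num at h; omega
    unfold indVal
    rw [hq]
    norm_num [Finset.prod_Icc_succ_top, Nat.choose]
  · have h := qval_bounds 3
    have hq : qval 5 = 8 := by norm_num at h; omega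
    unfold indVal
    rw [hq]
    norm_num [Finset.prod_Icc_succ_top, Nat.choose]
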